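/- arXiv:0709.1589 — 3 statements merged into one kernel-verified Lean document; each statement's English description precedes it below -/
import Mathlib

section
/- In an arbitrage-free discrete market model with proportional transaction costs, for an American option with adapted ℝ²-valued payoff (ξ,ζ), there exists a seller superhedging strategy (α,β) with (α_0,β_0) = (π^a(ξ,ζ), 0); in particular the infimum in the definition of π^a(ξ,ζ) is attained (by this strategy, whose initial cost −θ_0(−α_0,−β_0) equals π^a(ξ,ζ)). -/
open MeasureTheory
open scoped Pointwise

noncomputable section

namespace RZ

variable {Ω : Type*} [Fintype Ω]

/-- `ω` and `ω'` lie in the same atom of the σ-field `m`. -/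
def sameAtom (m : MeasurableSpace Ω) (ω ω' : Ω) : Prop :=
  ∀ A : Set Ω, MeasurableSet[m] A → (ω ∈ A ↔ ω' ∈ A)

/-- Elementary conditional expectation w.r.t. a σ-field on a finite space:
at `ω` it is the `P`-average of `f` over the atom of `ω`. -/
def condExp (m : MeasurableSpace Ω) (P : Ω → ℝ) (f : Ω → ℝ) (ω : Ω) : ℝ :=
  (∑ ω' : Ω, Set.indicator {ω'' | sameAtom m ω ω''} (fun ω'' => P ω'' * f ω'') ω') /
  (∑ ω' : Ω, Set.indicator {ω'' | sameAtom m ω ω''} P ω')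

/-- Expectation under `P`. -/
def expect (P : Ω → ℝ) (f : Ω → ℝ) : ℝ := ∑ ω : Ω, P ω * f ω

/-- Discrete market model with proportional transaction costs. -/
structure Market (Ω : Type*) [Fintype Ω] where
  T : ℕ
  T_pos : 0 < T
  F : ℕ → MeasurableSpace Ω
  F_mono : ∀ ⦃s t : ℕ⦄, s ≤ t → F s ≤ F t
  F_zero : F 0 = ⊥
  F_top : F T = ⊤
  Q : Ω → ℝ
  Q_pos : ∀ ω, 0 < Q ω
  Q_sum : ∑ ω, Q ω = 1
  Sb : ℕ → Ω → ℝ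
  Sa : ℕ → Ω → ℝ
  Sb_pos : ∀ t ω, t ≤ T → 0 < Sb t ω
  Sb_le_Sa : ∀ t ω, t ≤ T → Sb t ω ≤ Sa t ω
  Sb_adapted : ∀ t, t ≤ T → Measurable[F t] (Sb t)
  Sa_adapted : ∀ t, t ≤ T → Measurable[F t] (Sa t)

variable (M : Market Ω)

/-- Liquidation value θ_t(γ, δ) in scenario ω, for a cash position γ and stock position δ. -/
def liq (t : ℕ) (ω : Ω) (γ δ : ℝ) : ℝ :=
  γ + M.Sb t ω * max δ 0 - M.Sa t ω * max (-δ) 0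

/-- An adapted (real-valued) process. -/
def IsAdapted (X : ℕ → Ω → ℝ) : Prop := ∀ t, t ≤ M.T → Measurable[M.F t] (X t)

/-- An adapted ℝ²-valued payoff process. -/
def AdaptedPair (ξ ζ : ℕ → Ω → ℝ) : Prop := IsAdapted M ξ ∧ IsAdapted M ζ

/-- Self-financing strategy. -/
def SelfFinancing (α β : ℕ → Ω → ℝ) : Prop :=
  Measurable[M.F 0] (α 0) ∧ Measurable[M.F 0] (β 0) ∧
  (∀ t, t < M.T → Measurable[M.F t] (α (t + 1)) ∧ Measurable[M.F t] (β (t + 1))) ∧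
  (∀ t, t < M.T → ∀ ω, 0 ≤ liq M t ω (α t ω - α (t + 1) ω) (β t ω - β (t + 1) ω))

/-- Pure stopping time with values in {0,...,T}. -/
def IsStop (τ : Ω → ℕ) : Prop :=
  (∀ ω, τ ω ≤ M.T) ∧ ∀ t : ℕ, MeasurableSet[M.F t] {ω | τ ω = t}

/-- Seller superhedging strategy. -/
def SellerHedge (ξ ζ α β : ℕ → Ω → ℝ) : Prop :=
  SelfFinancing M α β ∧
  ∀ τ, IsStop M τ → ∀ ω,
    0 ≤ liq M (τ ω) ω (α (τ ω) ω - ξ (τ ω) ω) (β (τ ω) ω - ζ (τ ω) ω)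

/-- Buyer superhedging strategy. -/
def BuyerHedge (ξ ζ α β : ℕ → Ω → ℝ) : Prop :=
  SelfFinancing M α β ∧
  ∃ τ, IsStop M τ ∧ ∀ ω,
    0 ≤ liq M (τ ω) ω (α (τ ω) ω + ξ (τ ω) ω) (β (τ ω) ω + ζ (τ ω) ω)

/-- Seller's (ask) price: infimum of the initial costs of seller superhedging strategies. -/
def askPrice (ξ ζ : ℕ → Ω → ℝ) : ℝ :=
  sInf {x | ∃ α β, SellerHedge M ξ ζ α β ∧ ∀ ω, x = -liq M 0 ω (-α 0 ω) (-β 0 ω)}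

/-- Buyer's (bid) price: supremum of the amounts raised by buyer superhedging strategies. -/
def bidPrice (ξ ζ : ℕ → Ω → ℝ) : ℝ :=
  sSup {x | ∃ α β, BuyerHedge M ξ ζ α β ∧ ∀ ω, x = liq M 0 ω (-α 0 ω) (-β 0 ω)}

/-- Mixed stopping time. -/
def IsMixedStop (χ : ℕ → Ω → ℝ) : Prop :=
  (∀ t, t ≤ M.T → Measurable[M.F t] (χ t)) ∧ (∀ t ω, 0 ≤ χ t ω) ∧
  ∀ ω, ∑ t ∈ Finset.range (M.T + 1), χ t ω = 1

/-- χ*_t = Σ_{s=t}^T χ_s  (so χ*_{T+1} = 0). -/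
def chiStar (χ : ℕ → Ω → ℝ) (t : ℕ) (ω : Ω) : ℝ := ∑ s ∈ Finset.Icc t M.T, χ s ω

/-- Z^{χ*}_t = Σ_{s=t}^T χ_s Z_s  (so Z^{χ*}_{T+1} = 0). -/
def starVal (χ Z : ℕ → Ω → ℝ) (t : ℕ) (ω : Ω) : ℝ :=
  ∑ s ∈ Finset.Icc t M.T, χ s ω * Z s ω

/-- Z_χ = Σ_{t=0}^T χ_t Z_t. -/
def mixVal (χ Z : ℕ → Ω → ℝ) (ω : Ω) : ℝ :=
  ∑ t ∈ Finset.range (M.T + 1), χ t ω * Z t ω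

/-- Membership in the family barP(χ). -/
def memBarP (χ : ℕ → Ω → ℝ) (P : Ω → ℝ) (S : ℕ → Ω → ℝ) : Prop :=
  (∀ ω, 0 ≤ P ω) ∧ (∑ ω, P ω) = 1 ∧ IsAdapted M S ∧
  (∀ t ω, t ≤ M.T → M.Sb t ω ≤ S t ω ∧ S t ω ≤ M.Sa t ω) ∧
  (∀ t, t ≤ M.T → ∀ ω, 0 < P ω →
    chiStar M χ (t + 1) ω * M.Sb t ω ≤ condExp (M.F t) P (starVal M χ S (t + 1)) ω ∧
    condExp (M.F t) P (starVal M χ S (t + 1)) ω ≤ chiStar M χ (t + 1) ω * M.Sa t ω)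

/-- Membership in the family P(χ): barP(χ) with P equivalent to Q. -/
def memP (χ : ℕ → Ω → ℝ) (P : Ω → ℝ) (S : ℕ → Ω → ℝ) : Prop :=
  memBarP M χ P S ∧ ∀ ω, 0 < P ω

/-- The mixed stopping time χ^τ associated with a pure stopping time τ. -/
def pureChi (τ : Ω → ℕ) : ℕ → Ω → ℝ := fun t ω => if τ ω = t then 1 else 0

/-- Arbitrage-free: there is an equivalent probability measure and a martingale
between the bid and ask prices. -/
def ArbitrageFree : Prop :=
  ∃ (P : Ω → ℝ) (S : ℕ → Ω → ℝ),
    (∀ ω, 0 < P ω) ∧ (∑ ω, P ω) = 1 ∧ IsAdapted M S ∧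
    (∀ t ω, t ≤ M.T → M.Sb t ω ≤ S t ω ∧ S t ω ≤ M.Sa t ω) ∧
    (∀ t, t < M.T → ∀ ω, 0 < P ω → condExp (M.F t) P (S (t + 1)) ω = S t ω)

/-- Epigraph of a function ℝ → ℝ, as a subset of ℝ² (first coordinate dominates). -/
def epi (f : ℝ → ℝ) : Set (ℝ × ℝ) := {p | f p.2 ≤ p.1}

/-- The function h_{[b,a]}(y) = a y⁻ − b y⁺. -/
def hfun (b a : ℝ) (y : ℝ) : ℝ := a * max (-y) 0 - b * max y 0

/-- Seller's payoff function u_t(y) = ξ_t + (y − ζ_t)⁻ S^a_t − (y − ζ_t)⁺ S^b_t. -/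
def uSell (ξ ζ : ℕ → Ω → ℝ) (t : ℕ) (ω : Ω) (y : ℝ) : ℝ :=
  ξ t ω + M.Sa t ω * max (ζ t ω - y) 0 - M.Sb t ω * max (y - ζ t ω) 0

/-- Buyer's payoff function u_t(y) = −ξ_t + (y + ζ_t)⁻ S^a_t − (y + ζ_t)⁺ S^b_t. -/
def uBuy (ξ ζ : ℕ → Ω → ℝ) (t : ℕ) (ω : Ω) (y : ℝ) : ℝ :=
  -ξ t ω + M.Sa t ω * max (-(y + ζ t ω)) 0 - M.Sb t ω * max (y + ζ t ω) 0

/-- The seller's pricing recursion: one function per atom,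
`z_T = u_T` and `epi z_{t-1} = epi u_{t-1} ∩ (epi h + ⋂_{succ} epi z_t)`. -/
def SellerRec (ξ ζ : ℕ → Ω → ℝ) (z : ℕ → Ω → ℝ → ℝ) : Prop :=
  (∀ t ω ω', t ≤ M.T → sameAtom (M.F t) ω ω' → z t ω = z t ω') ∧
  (∀ ω, z M.T ω = uSell M ξ ζ M.T ω) ∧
  (∀ t ω, t < M.T →
    epi (z t ω) = epi (uSell M ξ ζ t ω) ∩
      (epi (hfun (M.Sb t ω) (M.Sa t ω)) +
        ⋂ ω' ∈ {ω'' | sameAtom (M.F t) ω ω''}, epi (z (t + 1) ω')))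

/-- The buyer's pricing recursion: one function per atom,
`z_T = u_T` and `epi z_{t-1} = epi u_{t-1} ∪ (epi h + ⋂_{succ} epi z_t)`. -/
def BuyerRec (ξ ζ : ℕ → Ω → ℝ) (z : ℕ → Ω → ℝ → ℝ) : Prop :=
  (∀ t ω ω', t ≤ M.T → sameAtom (M.F t) ω ω' → z t ω = z t ω') ∧
  (∀ ω, z M.T ω = uBuy M ξ ζ M.T ω) ∧
  (∀ t ω, t < M.T →
    epi (z t ω) = epi (uBuy M ξ ζ t ω) ∪
      (epi (hfun (M.Sb t ω) (M.Sa t ω)) +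
        ⋂ ω' ∈ {ω'' | sameAtom (M.F t) ω ω''}, epi (z (t + 1) ω')))

section Polyhedra

variable {E : Type*} [AddCommGroup E] [Module ℝ E]

/-- A set cut out by finitely many affine inequalities. -/
def IsPolyhedral (s : Set E) : Prop :=
  ∃ C : Set (Module.Dual ℝ E × ℝ), C.Finite ∧ s = {x | ∀ c ∈ C, c.1 x ≤ c.2}

lemma isPolyhedral_setOf_nonneg (f : Module.Dual ℝ E) (r : ℝ) :
    IsPolyhedral {x | 0 ≤ f x + r} := by
  refine ⟨{(-f, r)}, Set.finite_singleton _, ?_⟩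
  ext x
  simp [neg_le_iff_add_nonneg']

lemma IsPolyhedral.inter {s t : Set E} (hs : IsPolyhedral s) (ht : IsPolyhedral t) :
    IsPolyhedral (s ∩ t) := by
  obtain ⟨C, hC, rfl⟩ := hs
  obtain ⟨D, hD, rfl⟩ := ht
  refine ⟨C ∪ D, hC.union hD, ?_⟩
  ext x
  simp only [Set.mem_inter_iff, Set.mem_ofPred_eq, Set.mem_union, or_imp, forall_and]

lemma IsPolyhedral.setOf_forall {ι : Type*} [Finite ι] {p : ι → E → Prop}
    (h : ∀ i, IsPolyhedral {x | p i x}) : IsPolyhedral {x | ∀ i, p i x} := by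
  choose C hC hs using h
  refine ⟨⋃ i, C i, Set.finite_iUnion hC, ?_⟩
  ext x
  have key : ∀ i, p i x ↔ ∀ c ∈ C i, c.1 x ≤ c.2 := fun i => Set.ext_iff.1 (hs i) x
  simp only [Set.mem_ofPred_eq, Set.mem_iUnion, key]
  exact ⟨fun h c ⟨i, hi⟩ => h i c hi, fun h i c hc => h c ⟨i, hc⟩⟩

lemma exists_between_of_finite {A B : Set ℝ} (hA : A.Finite) (hB : B.Finite)
    (h : ∀ a ∈ A, ∀ b ∈ B, a ≤ b) : ∃ t, (∀ a ∈ A, a ≤ t) ∧ ∀ b ∈ B, t ≤ b := by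
  rcases A.eq_empty_or_nonempty with rfl | hA'
  · obtain ⟨t, ht⟩ := hB.bddBelow
    exact ⟨t, by simp, fun b hb => ht hb⟩
  · exact ⟨sSup A, fun a ha => le_csSup hA.bddAbove ha, fun b hb =>
      csSup_le hA' fun a ha => h a ha b hb⟩

/-- Fourier–Motzkin elimination of one direction. -/
lemma IsPolyhedral.eliminate {s : Set E} (hs : IsPolyhedral s) (v : E) :
    IsPolyhedral {x | ∃ t : ℝ, x + t • v ∈ s} := by
  obtain ⟨C, hC, rfl⟩ := hs
  have hpos : {c ∈ C | 0 < c.1 v}.Finite := hC.subset (Set.sep_subset _ _)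
  have hneg : {c ∈ C | c.1 v < 0}.Finite := hC.subset (Set.sep_subset _ _)
  refine ⟨{c ∈ C | c.1 v = 0} ∪ Set.image2
    (fun p n => (p.1 v • n.1 - n.1 v • p.1, p.1 v * n.2 - n.1 v * p.2))
    {c ∈ C | 0 < c.1 v} {c ∈ C | c.1 v < 0},
    (hC.subset (Set.sep_subset _ _)).union (hpos.image2 _ hneg), ?_⟩
  ext x
  simp only [Set.mem_ofPred_eq, map_add, map_smul, smul_eq_mul]
  constructor
  · rintro ⟨t, ht⟩ c (⟨hc, hc0⟩ | ⟨p, ⟨hp, hp0⟩, n, ⟨hn, hn0⟩, rfl⟩)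
    · simpa [hc0] using ht c hc
    · have h1 := mul_le_mul_of_nonneg_left (ht n hn) hp0.le
      have h2 := mul_le_mul_of_nonneg_left (ht p hp) (neg_nonneg.2 hn0.le)
      simp only [LinearMap.sub_apply, LinearMap.smul_apply, smul_eq_mul]
      linarith
  · intro h
    obtain ⟨t, htA, htB⟩ := exists_between_of_finite
      (hneg.image fun c => (c.2 - c.1 x) / c.1 v) (hpos.image fun c => (c.2 - c.1 x) / c.1 v) (by
        rintro _ ⟨n, ⟨hn, hn0⟩, rfl⟩ _ ⟨p, ⟨hp, hp0⟩, rfl⟩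
        have := h _ (Or.inr ⟨p, ⟨hp, hp0⟩, n, ⟨hn, hn0⟩, rfl⟩)
        simp only [LinearMap.sub_apply, LinearMap.smul_apply, smul_eq_mul] at this
        rw [le_div_iff₀ hp0, div_mul_eq_mul_div, div_le_iff_of_neg hn0]
        linarith)
    refine ⟨t, fun c hc => ?_⟩
    rcases lt_trichotomy (c.1 v) 0 with hc0 | hc0 | hc0
    · have := htA _ ⟨c, ⟨hc, hc0⟩, rfl⟩
      rw [div_le_iff_of_neg hc0] at this
      linarith
    · simpa [hc0] using h c (Or.inl ⟨hc, hc0⟩)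
    · have := htB _ ⟨c, ⟨hc, hc0⟩, rfl⟩
      rw [le_div_iff₀ hc0] at this
      linarith

lemma IsPolyhedral.eliminate_submodule {s : Set E} (hs : IsPolyhedral s) {N : Submodule ℝ E}
    (hN : N.FG) : IsPolyhedral {x | ∃ k ∈ N, x + k ∈ s} := by
  induction N, hN using Submodule.fg_induction generalizing s with
  | singleton v => simpa [Submodule.mem_span_singleton] using hs.eliminate v
  | sup N₁ N₂ _ _ h₁ h₂ =>
    convert h₂ (h₁ hs) using 1
    ext x
    constructor
    · rintro ⟨k, hk, hx⟩
      obtain ⟨y, hy, z, hz, rfl⟩ := Submodule.mem_sup.1 hk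
      exact ⟨z, hz, y, hy, by rwa [add_assoc, add_comm z]⟩
    · rintro ⟨z, hz, y, hy, hx⟩
      exact ⟨y + z, Submodule.add_mem_sup hy hz, by rwa [add_comm y, ← add_assoc]⟩

/-- The image of a polyhedral set under a linear functional is closed. -/
lemma IsPolyhedral.isClosed_image [FiniteDimensional ℝ E] {s : Set E} (hs : IsPolyhedral s)
    (g : Module.Dual ℝ E) : IsClosed (g '' s) := by
  by_cases hg : g = 0
  · subst hg
    exact (Set.Subsingleton.finite (by rintro _ ⟨x, -, rfl⟩ _ ⟨y, -, rfl⟩; rfl)).isClosed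
  obtain ⟨w, hw⟩ := LinearMap.surjective hg 1
  obtain ⟨C, -, hC⟩ := hs.eliminate_submodule (IsNoetherian.noetherian (LinearMap.ker g))
  have himage : g '' s = {r | ∀ c ∈ C, r * c.1 w ≤ c.2} := by
    ext r
    have : r • w ∈ {x | ∃ k ∈ LinearMap.ker g, x + k ∈ s} ↔ ∀ c ∈ C, r * c.1 w ≤ c.2 := by
      rw [hC]
      simp
    rw [Set.mem_ofPred_eq, ← this]
    constructor
    · rintro ⟨x, hx, rfl⟩
      exact ⟨x - g x • w, by simp [hw], by simpa using hx⟩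
    · rintro ⟨k, hk, hx⟩
      exact ⟨_, hx, by simp [hw, LinearMap.mem_ker.1 hk]⟩
  rw [himage, Set.ofPred_forall]
  refine isClosed_iInter fun c => ?_
  rw [Set.ofPred_forall]
  exact isClosed_iInter fun _ => isClosed_le (by fun_prop) (by fun_prop)

end Polyhedra

lemma liq_nonneg_iff {t : ℕ} (ht : t ≤ M.T) {ω : Ω} {γ δ : ℝ} :
    0 ≤ liq M t ω γ δ ↔ 0 ≤ γ + M.Sb t ω * δ ∧ 0 ≤ γ + M.Sa t ω * δ := by
  have h := M.Sb_le_Sa t ω ht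
  rcases le_total 0 δ with hδ | hδ
  · have := mul_le_mul_of_nonneg_right h hδ
    rw [liq, max_eq_left hδ, max_eq_right (neg_nonpos.2 hδ)]
    constructor
    · intro h; constructor <;> linarith
    · rintro ⟨h, -⟩; linarith
  · have := mul_le_mul_of_nonpos_right h hδ
    rw [liq, max_eq_right hδ, max_eq_left (neg_nonneg.2 hδ)]
    constructor
    · intro h; constructor <;> linarith
    · rintro ⟨-, h⟩; linarith

lemma liq_nonneg_add {t : ℕ} (ht : t ≤ M.T) {ω : Ω} {γ δ γ' δ' : ℝ}
    (h : 0 ≤ liq M t ω γ δ) (h' : 0 ≤ liq M t ω γ' δ') :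
    0 ≤ liq M t ω (γ + γ') (δ + δ') := by
  rw [liq_nonneg_iff M ht] at *
  constructor <;> linarith [h.1, h.2, h'.1, h'.2]

lemma isPolyhedral_setOf_liq_nonneg {E : Type*} [AddCommGroup E] [Module ℝ E] {t : ℕ}
    (ht : t ≤ M.T) (ω : Ω) (f g : Module.Dual ℝ E) (c d : ℝ) :
    IsPolyhedral {x | 0 ≤ liq M t ω (f x - c) (g x - d)} := by
  convert (isPolyhedral_setOf_nonneg (f + M.Sb t ω • g) (-c - M.Sb t ω * d)).inter
    (isPolyhedral_setOf_nonneg (f + M.Sa t ω • g) (-c - M.Sa t ω * d)) using 1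
  ext x
  simp only [Set.mem_ofPred_eq, Set.mem_inter_iff, liq_nonneg_iff M ht, LinearMap.add_apply,
    LinearMap.smul_apply, smul_eq_mul]
  ring_nf

lemma sellerHedge_iff (ξ ζ α β : ℕ → Ω → ℝ) :
    SellerHedge M ξ ζ α β ↔ SelfFinancing M α β ∧
      ∀ t, t ≤ M.T → ∀ ω, 0 ≤ liq M t ω (α t ω - ξ t ω) (β t ω - ζ t ω) :=
  and_congr_right fun _ =>
    ⟨fun h t ht => h (fun _ => t) ⟨fun _ => ht, fun _ => MeasurableSet.const _⟩,
      fun h τ hτ ω => h (τ ω) (hτ.1 ω) ω⟩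

/-- A hedge may be started from its initial cost held entirely in cash. -/
lemma SellerHedge.update_cash {ξ ζ α β : ℕ → Ω → ℝ} (h : SellerHedge M ξ ζ α β) {x : ℝ}
    (hx : ∀ ω, x = -liq M 0 ω (-α 0 ω) (-β 0 ω)) :
    SellerHedge M ξ ζ (Function.update α 0 fun _ => x) (Function.update β 0 fun _ => 0) := by
  rw [sellerHedge_iff] at *
  obtain ⟨⟨-, -, hm, hsf⟩, hpay⟩ := h
  have h0 : ∀ ω, 0 ≤ liq M 0 ω (x - α 0 ω) (0 - β 0 ω) := fun ω => by
    have := hx ω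
    simp only [liq, zero_sub] at this ⊢
    linarith
  refine ⟨⟨by simp, by simp, fun t ht => ?_, fun t ht ω => ?_⟩, fun t ht ω => ?_⟩
  · simpa using hm t ht
  · rcases t with _ | t
    · simpa [← add_sub_assoc] using liq_nonneg_add M (Nat.zero_le _) (h0 ω) (hsf 0 ht ω)
    · simpa using hsf (t + 1) ht ω
  · rcases t with _ | t
    · simpa [← add_sub_assoc] using liq_nonneg_add M (Nat.zero_le _) (h0 ω) (hpay 0 ht ω)
    · simpa using hpay (t + 1) ht ω

/-- Pairs of predictable processes on `{0, …, T}` whose initial stock position is zero. -/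
def predictable :
    Submodule ℝ ((Fin (M.T + 1) → Ω → ℝ) × (Fin (M.T + 1) → Ω → ℝ)) where
  carrier := {p | (∀ t : Fin (M.T + 1), Measurable[M.F (t.val - 1)] (p.1 t) ∧
    Measurable[M.F (t.val - 1)] (p.2 t)) ∧ p.2 0 = 0}
  add_mem' {p q} hp hq := ⟨fun t =>
    ⟨(hp.1 t).1.add (hq.1 t).1, (hp.1 t).2.add (hq.1 t).2⟩, by simp [hp.2, hq.2]⟩
  zero_mem' := ⟨fun t => ⟨@measurable_const _ _ _ (M.F (t.val - 1)) 0,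
    @measurable_const _ _ _ (M.F (t.val - 1)) 0⟩, rfl⟩
  smul_mem' r p hp := ⟨fun t =>
    ⟨(hp.1 t).1.const_mul r, (hp.1 t).2.const_mul r⟩, by simp [hp.2]⟩

lemma mem_predictable_iff {p : (Fin (M.T + 1) → Ω → ℝ) × (Fin (M.T + 1) → Ω → ℝ)} :
    p ∈ predictable M ↔ (∀ t : Fin (M.T + 1), Measurable[M.F (t.val - 1)] (p.1 t) ∧
      Measurable[M.F (t.val - 1)] (p.2 t)) ∧ p.2 0 = 0 := by
  rw [predictable]
  exact Iff.rfl

/-- Cash position at time `t` in scenario `ω`. -/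
def cash (t : ℕ) (ω : Ω) : Module.Dual ℝ (predictable M) :=
  LinearMap.proj ω ∘ₗ LinearMap.proj (Fin.ofNat (M.T + 1) t) ∘ₗ LinearMap.fst ℝ _ _ ∘ₗ
    (predictable M).subtype

/-- Stock position at time `t` in scenario `ω`. -/
def stock (t : ℕ) (ω : Ω) : Module.Dual ℝ (predictable M) :=
  LinearMap.proj ω ∘ₗ LinearMap.proj (Fin.ofNat (M.T + 1) t) ∘ₗ LinearMap.snd ℝ _ _ ∘ₗ
    (predictable M).subtype

/-- Predictable processes that superhedge the seller's position. -/
def hedges (ξ ζ : ℕ → Ω → ℝ) : Set (predictable M) :=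
  {p | SellerHedge M ξ ζ (fun t ω => cash M t ω p) (fun t ω => stock M t ω p)}

lemma selfFinancing_predictable_iff (p : predictable M) :
    SelfFinancing M (fun t ω => cash M t ω p) (fun t ω => stock M t ω p) ↔
      ∀ t, t < M.T → ∀ ω, 0 ≤ liq M t ω (cash M t ω p - cash M (t + 1) ω p)
        (stock M t ω p - stock M (t + 1) ω p) := by
  have hp := (mem_predictable_iff M).1 p.2
  refine ⟨fun h => h.2.2.2, fun h => ⟨(hp.1 0).1, (hp.1 0).2, fun t ht => ?_, h⟩⟩
  have hmod : (Fin.ofNat (M.T + 1) (t + 1) : ℕ) = t + 1 := by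
    simp [Fin.ofNat, Nat.mod_eq_of_lt (Nat.succ_lt_succ ht)]
  have := hp.1 (Fin.ofNat (M.T + 1) (t + 1))
  rw [hmod, Nat.add_sub_cancel] at this
  exact this

lemma isPolyhedral_hedges (ξ ζ : ℕ → Ω → ℝ) : IsPolyhedral (hedges M ξ ζ) := by
  have h₁ : IsPolyhedral {p : predictable M | ∀ t : Fin M.T, ∀ ω,
      0 ≤ liq M t ω ((cash M t ω - cash M (t + 1) ω) p - 0)
        ((stock M t ω - stock M (t + 1) ω) p - 0)} :=
    .setOf_forall fun t => .setOf_forall fun ω => isPolyhedral_setOf_liq_nonneg M t.2.le ω _ _ _ _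
  have h₂ : IsPolyhedral {p : predictable M | ∀ t : Fin (M.T + 1), ∀ ω,
      0 ≤ liq M t ω (cash M t ω p - ξ t ω) (stock M t ω p - ζ t ω)} :=
    .setOf_forall fun t => .setOf_forall fun ω =>
      isPolyhedral_setOf_liq_nonneg M (Nat.le_of_lt_succ t.2) ω _ _ _ _
  convert h₁.inter h₂ using 1
  ext p
  simp only [hedges, sellerHedge_iff, selfFinancing_predictable_iff, Set.mem_ofPred_eq,
    Set.mem_inter_iff, Fin.forall_iff, Nat.lt_succ_iff, LinearMap.sub_apply, sub_zero]

lemma SelfFinancing.mem_predictable {α β : ℕ → Ω → ℝ} (h : SelfFinancing M α β)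
    (hβ : β 0 = 0) :
    ((fun t => α t, fun t => β t) : (Fin (M.T + 1) → Ω → ℝ) × (Fin (M.T + 1) → Ω → ℝ)) ∈
      predictable M := by
  refine (mem_predictable_iff M).2 ⟨fun t => ?_, hβ⟩
  rcases t with ⟨_ | t, ht⟩
  · exact ⟨h.1, h.2.1⟩
  · exact h.2.2.1 t (Nat.lt_of_succ_lt_succ ht)

lemma liq_neg_cash (t : ℕ) (ω : Ω) (x : ℝ) : -liq M t ω (-x) (-0) = x := by
  simp [liq]

/-- The costs of superhedging are the initial cash positions of the hedges in `hedges M ξ ζ`. -/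
lemma setOf_cost_eq_image (ξ ζ : ℕ → Ω → ℝ) (ω₀ : Ω) :
    {x | ∃ α β, SellerHedge M ξ ζ α β ∧ ∀ ω, x = -liq M 0 ω (-α 0 ω) (-β 0 ω)} =
      cash M 0 ω₀ '' hedges M ξ ζ := by
  ext x
  constructor
  · rintro ⟨α, β, h, hx⟩
    have h' := h.update_cash M hx
    refine ⟨⟨_, h'.1.mem_predictable M (by ext; simp)⟩, ?_, by simp [cash]⟩
    rw [hedges, Set.mem_ofPred_eq, sellerHedge_iff, selfFinancing_predictable_iff]
    rw [sellerHedge_iff] at h'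
    have hmod : ∀ t, t ≤ M.T → t % (M.T + 1) = t := fun t ht =>
      Nat.mod_eq_of_lt (Nat.lt_succ_of_le ht)
    constructor
    · intro t ht ω
      simpa [cash, stock, hmod t ht.le, hmod (t + 1) ht] using h'.1.2.2.2 t ht ω
    · intro t ht ω
      simpa [cash, stock, hmod t ht] using h'.2 t ht ω
  · rintro ⟨p, hp, rfl⟩
    refine ⟨_, _, hp, fun ω => ?_⟩
    have : Nonempty Ω := ⟨ω₀⟩
    obtain ⟨c, hc⟩ := eq_const_of_measurable_bot (M.F_zero ▸ hp.1.1)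
    have hconst : cash M 0 ω₀ p = cash M 0 ω p := (congrFun hc ω₀).trans (congrFun hc ω).symm
    have hstock : stock M 0 ω p = 0 := congrFun ((mem_predictable_iff M).1 p.2).2 ω
    rw [hstock, liq_neg_cash, hconst]

lemma setOf_cost_nonempty (ξ ζ : ℕ → Ω → ℝ) :
    {x | ∃ α β, SellerHedge M ξ ζ α β ∧
      ∀ ω, x = -liq M 0 ω (-α 0 ω) (-β 0 ω)}.Nonempty := by
  obtain ⟨x, hx⟩ : BddAbove (Set.range fun q : Fin (M.T + 1) × Ω =>
      -liq M q.1 q.2 (-ξ q.1 q.2) (-ζ q.1 q.2)) := (Set.finite_range _).bddAbove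
  refine ⟨x, fun _ _ => x, fun _ _ => 0, (sellerHedge_iff M _ _ _ _).2 ⟨⟨?_, ?_, ?_, ?_⟩, ?_⟩, ?_⟩
  · exact measurable_const
  · exact measurable_const
  · exact fun _ _ => ⟨measurable_const, measurable_const⟩
  · simp [liq]
  · intro t ht ω
    have := hx ⟨(⟨t, Nat.lt_succ_of_le ht⟩, ω), rfl⟩
    simp only [liq, zero_sub] at this ⊢
    linarith
  · simp [liq]

lemma setOf_cost_bddBelow (ξ ζ : ℕ → Ω → ℝ) (ω₀ : Ω) :
    BddBelow {x | ∃ α β, SellerHedge M ξ ζ α β ∧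
      ∀ ω, x = -liq M 0 ω (-α 0 ω) (-β 0 ω)} := by
  refine ⟨-liq M 0 ω₀ (-ξ 0 ω₀) (-ζ 0 ω₀), ?_⟩
  rintro x ⟨α, β, h, hx⟩
  have := ((sellerHedge_iff M _ _ _ _).1 (h.update_cash M hx)).2 0 (Nat.zero_le _) ω₀
  simp only [liq, zero_sub, Function.update_self] at this ⊢
  linarith

/-- Corollary: there is a seller superhedging strategy starting from the portfolio
(π^a(ξ,ζ), 0); it attains the infimum defining the seller's price. -/
theorem seller_optimal_strategy (ξ ζ : ℕ → Ω → ℝ)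
    (hpay : AdaptedPair M ξ ζ) (hNA : ArbitrageFree M) :
    ∃ α β, SellerHedge M ξ ζ α β ∧
      (∀ ω, α 0 ω = askPrice M ξ ζ ∧ β 0 ω = 0) ∧
      ∀ ω, -liq M 0 ω (-α 0 ω) (-β 0 ω) = askPrice M ξ ζ := by
  obtain ⟨ω₀⟩ : Nonempty Ω := by
    by_contra h
    rw [not_nonempty_iff] at h
    simpa using M.Q_sum
  obtain ⟨α, β, h, hx⟩ := IsClosed.csInf_mem
    (setOf_cost_eq_image M ξ ζ ω₀ ▸ (isPolyhedral_hedges M ξ ζ).isClosed_image (cash M 0 ω₀))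
    (setOf_cost_nonempty M ξ ζ) (setOf_cost_bddBelow M ξ ζ ω₀)
  exact ⟨_, _, h.update_cash M hx, fun _ => by simp [askPrice], fun _ => by simp [askPrice, liq]⟩

end RZ
end
end

section
/- Let (α,β) be a self-financing strategy, χ a mixed stopping time, and (P,S) ∈ barP(χ). Then for every t = 0,...,T one has, P-almost surely, E_P(χ*_t α_t + S_t^{χ*} β_t | F_t) ≥ E_P((α + Sβ)_t^{χ*} | F_t), where (α + Sβ)_t^{χ*} = Σ_{s=t}^T χ_s (α_s + S_s β_s). In particular (taking t = 0), α_0 + E_P(S_χ) β_0 ≥ E_P((α + Sβ)_χ). -/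
open MeasureTheory
open scoped Pointwise

noncomputable section

namespace RZ

variable {Ω : Type*} [Fintype Ω]

variable (M : Market Ω)

section ConditionalExpectation

theorem sameAtom_comm {Ω : Type*} {m : MeasurableSpace Ω} {ω ω' : Ω} : sameAtom m ω ω' ↔ sameAtom m ω' ω :=
  forall₂_congr fun _ _ => Iff.comm

theorem sameAtom.trans {Ω : Type*} {m : MeasurableSpace Ω} {ω ω' ω'' : Ω}
    (h : sameAtom m ω ω') (h' : sameAtom m ω' ω'') : sameAtom m ω ω'' :=
  fun A hA => (h A hA).trans (h' A hA)

theorem sameAtom.eq_of_measurable {Ω : Type*} {m : MeasurableSpace Ω} {g : Ω → ℝ}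
    (hg : Measurable[m] g) {ω ω' : Ω} (h : sameAtom m ω ω') : g ω = g ω' :=
  ((h _ (hg (measurableSet_singleton (g ω)))).1 rfl).symm

variable {m : MeasurableSpace Ω}

theorem measurableSet_atom (ω : Ω) : MeasurableSet[m] {ω' | sameAtom m ω ω'} := by
  simp only [sameAtom, Set.ofPred_forall]
  refine MeasurableSet.iInter fun A => MeasurableSet.iInter fun hA => ?_
  by_cases h : ω ∈ A
  · simp only [h, true_iff]
    exact hA
  · simp only [h, false_iff]
    exact hA.compl

theorem condExp_eq_of_sameAtom (P f : Ω → ℝ) {ω ω' : Ω} (h : sameAtom m ω ω') :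
    condExp m P f ω = condExp m P f ω' := by
  have hset : {ω'' | sameAtom m ω ω''} = {ω'' | sameAtom m ω' ω''} :=
    Set.ext fun _ => ⟨(sameAtom_comm.1 h).trans, h.trans⟩
  simp only [condExp, hset]

theorem atom_mass_pos {P : Ω → ℝ} (hP : ∀ ω, 0 ≤ P ω) {ω : Ω} (hω : 0 < P ω) :
    0 < ∑ ω' : Ω, Set.indicator {ω'' | sameAtom m ω ω''} P ω' :=
  Finset.sum_pos' (fun ω' _ => Set.indicator_nonneg (fun x _ => hP x) ω')
    ⟨ω, Finset.mem_univ _, by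
      rwa [Set.indicator_of_mem (show ω ∈ {ω'' | sameAtom m ω ω''} from fun _ _ => Iff.rfl)]⟩

/-- Averaging property of the conditional expectation. -/
theorem sum_indicator_condExp {P : Ω → ℝ} (hP : ∀ ω, 0 ≤ P ω) (f : Ω → ℝ) {A : Set Ω}
    (hA : MeasurableSet[m] A) :
    ∑ ω, A.indicator (fun ω => P ω * condExp m P f ω) ω =
      ∑ ω, A.indicator (fun ω => P ω * f ω) ω := by
  classical
  have swap : ∀ ω ω' : Ω,
      A.indicator (fun ω => P ω * (Set.indicator {ω'' | sameAtom m ω ω''}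
        (fun ω'' => P ω'' * f ω'') ω' /
          ∑ x : Ω, Set.indicator {ω'' | sameAtom m ω ω''} P x)) ω =
      A.indicator (fun ω' => P ω' * f ω' * (Set.indicator {ω'' | sameAtom m ω' ω''} P ω /
          ∑ x : Ω, Set.indicator {ω'' | sameAtom m ω' ω''} P x)) ω' := by
    intro ω ω'
    by_cases h : sameAtom m ω ω'
    · have hset : {ω'' | sameAtom m ω ω''} = {ω'' | sameAtom m ω' ω''} :=
        Set.ext fun _ => ⟨(sameAtom_comm.1 h).trans, h.trans⟩
      have hω : sameAtom m ω' ω := sameAtom_comm.1 h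
      have hω' : sameAtom m ω' ω' := fun _ _ => Iff.rfl
      by_cases hmem : ω ∈ A
      · have hmem' : ω' ∈ A := (h A hA).1 hmem
        simp only [Set.indicator_of_mem hmem, Set.indicator_of_mem hmem', hset]
        rw [Set.indicator_of_mem (show ω' ∈ {ω'' | sameAtom m ω' ω''} from hω'),
          Set.indicator_of_mem (show ω ∈ {ω'' | sameAtom m ω' ω''} from hω)]
        ring
      · have hmem' : ω' ∉ A := fun hc => hmem ((h A hA).2 hc)
        simp only [Set.indicator_of_notMem hmem, Set.indicator_of_notMem hmem']
    · have h' : ¬ sameAtom m ω' ω := fun hc => h (sameAtom_comm.1 hc)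
      simp [Set.indicator, h, h']
  calc ∑ ω, A.indicator (fun ω => P ω * condExp m P f ω) ω
      = ∑ ω, ∑ ω', A.indicator (fun ω => P ω * (Set.indicator {ω'' | sameAtom m ω ω''}
          (fun ω'' => P ω'' * f ω'') ω' /
            ∑ x : Ω, Set.indicator {ω'' | sameAtom m ω ω''} P x)) ω := by
        refine Finset.sum_congr rfl fun ω _ => ?_
        by_cases hmem : ω ∈ A
        · simp only [Set.indicator_of_mem hmem, condExp, Finset.mul_sum, Finset.sum_div]
        · simp only [Set.indicator_of_notMem hmem, Finset.sum_const_zero]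
    _ = ∑ ω', ∑ ω, A.indicator (fun ω' => P ω' * f ω' *
          (Set.indicator {ω'' | sameAtom m ω' ω''} P ω /
            ∑ x : Ω, Set.indicator {ω'' | sameAtom m ω' ω''} P x)) ω' := by
        rw [Finset.sum_comm]
        simp only [swap]
    _ = ∑ ω, A.indicator (fun ω => P ω * f ω) ω := by
        refine Finset.sum_congr rfl fun ω' _ => ?_
        by_cases hmem : ω' ∈ A
        · simp only [Set.indicator_of_mem hmem, ← Finset.mul_sum, ← Finset.sum_div]
          rcases (hP ω').eq_or_lt with h0 | hpos
          · simp [← h0]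
          · rw [div_self (atom_mass_pos hP hpos).ne', mul_one]
        · simp only [Set.indicator_of_notMem hmem, Finset.sum_const_zero]

theorem condExp_mul_add_mul {P : Ω → ℝ} (hP : ∀ ω, 0 ≤ P ω) {g h : Ω → ℝ}
    (hg : Measurable[m] g) (hh : Measurable[m] h) (f : Ω → ℝ) {ω : Ω} (hω : 0 < P ω) :
    condExp m P (fun ω => g ω + h ω * f ω) ω = g ω + h ω * condExp m P f ω := by
  have hne := (atom_mass_pos (m := m) hP hω).ne'
  rw [condExp, condExp, div_eq_iff hne, add_mul, mul_assoc, div_mul_cancel₀ _ hne,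
    Finset.mul_sum, Finset.mul_sum, ← Finset.sum_add_distrib]
  refine Finset.sum_congr rfl fun ω' _ => ?_
  by_cases hs : sameAtom m ω ω'
  · simp only [Set.indicator_of_mem (show ω' ∈ {ω'' | sameAtom m ω ω''} from hs),
      hs.eq_of_measurable hg, hs.eq_of_measurable hh]
    ring
  · simp [Set.indicator, hs]

theorem condExp_le_condExp {P : Ω → ℝ} (hP : ∀ ω, 0 ≤ P ω) {f g : Ω → ℝ}
    (hfg : ∀ A : Set Ω, MeasurableSet[m] A →
      ∑ ω, A.indicator (fun ω => P ω * f ω) ω ≤ ∑ ω, A.indicator (fun ω => P ω * g ω) ω)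
    (ω : Ω) : condExp m P f ω ≤ condExp m P g ω :=
  div_le_div_of_nonneg_right (hfg _ (measurableSet_atom ω))
    (Finset.sum_nonneg fun ω' _ => Set.indicator_nonneg (fun x _ => hP x) ω')

end ConditionalExpectation

section Market

variable {M}

theorem starVal_eq_add {χ : ℕ → Ω → ℝ} (Z : ℕ → Ω → ℝ) {t : ℕ} (ht : t ≤ M.T) (ω : Ω) :
    starVal M χ Z t ω = χ t ω * Z t ω + starVal M χ Z (t + 1) ω := by
  simp only [starVal]
  rw [← Finset.add_sum_Ioc_eq_sum_Icc ht, Finset.Icc_add_one_left_eq_Ioc]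

theorem chiStar_eq_add {χ : ℕ → Ω → ℝ} {t : ℕ} (ht : t ≤ M.T) (ω : Ω) :
    chiStar M χ t ω = χ t ω + chiStar M χ (t + 1) ω := by
  simp only [chiStar]
  rw [← Finset.add_sum_Ioc_eq_sum_Icc ht, Finset.Icc_add_one_left_eq_Ioc]

theorem chiStar_zero {χ : ℕ → Ω → ℝ} (hχ : IsMixedStop M χ) (ω : Ω) : chiStar M χ 0 ω = 1 := by
  rw [← hχ.2.2 ω, chiStar, Finset.range_eq_Ico]
  rfl

theorem starVal_zero (χ Z : ℕ → Ω → ℝ) : starVal M χ Z 0 = mixVal M χ Z := by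
  funext ω
  rw [starVal, mixVal, Finset.range_eq_Ico]
  rfl

/-- The process `χ*` is predictable. -/
theorem measurable_chiStar_succ {χ : ℕ → Ω → ℝ} (hχ : IsMixedStop M χ) {t : ℕ}
    (ht : t ≤ M.T) : Measurable[M.F t] (chiStar M χ (t + 1)) := by
  have key : ∀ t ≤ M.T, Measurable[M.F t] (chiStar M χ t) →
      Measurable[M.F t] (chiStar M χ (t + 1)) := by
    intro t ht h
    have heq : chiStar M χ (t + 1) = fun ω => chiStar M χ t ω - χ t ω := by
      funext ω
      rw [chiStar_eq_add ht]
      ring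
    rw [heq]
    exact h.sub (hχ.1 t ht)
  induction t with
  | zero =>
    refine key 0 ht ?_
    have heq : chiStar M χ 0 = fun _ => 1 := funext (chiStar_zero hχ)
    rw [heq]
    exact measurable_const
  | succ t ih =>
    exact key _ ht ((ih (by omega)).mono (M.F_mono t.le_succ) le_rfl)

theorem SelfFinancing.measurable_sub {α β : ℕ → Ω → ℝ} (h : SelfFinancing M α β) {t : ℕ}
    (ht : t < M.T) : Measurable[M.F t] (fun ω => α t ω - α (t + 1) ω) ∧
      Measurable[M.F t] (fun ω => β t ω - β (t + 1) ω) := by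
  have hαβ : Measurable[M.F t] (α t) ∧ Measurable[M.F t] (β t) := by
    cases t with
    | zero => exact ⟨h.1, h.2.1⟩
    | succ t =>
      have := h.2.2.1 t (by omega)
      exact ⟨this.1.mono (M.F_mono t.le_succ) le_rfl, this.2.mono (M.F_mono t.le_succ) le_rfl⟩
  exact ⟨hαβ.1.sub (h.2.2.1 t ht).1, hαβ.2.sub (h.2.2.1 t ht).2⟩

/-- The portfolio exchanged at a self-financing trade, held until `χ` stops it, has nonnegative
expected value on every event known at the time of the trade. -/
theorem trade_value_nonneg {α β χ S : ℕ → Ω → ℝ} {P : Ω → ℝ}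
    (hsf : SelfFinancing M α β) (hχ : IsMixedStop M χ) (hPS : memBarP M χ P S) {t : ℕ}
    (ht : t < M.T) {A : Set Ω} (hA : MeasurableSet[M.F t] A) :
    0 ≤ ∑ ω, A.indicator (fun ω => P ω *
      (chiStar M χ (t + 1) ω * (α t ω - α (t + 1) ω) +
        (β t ω - β (t + 1) ω) * starVal M χ S (t + 1) ω)) ω := by
  obtain ⟨hP, -, -, -, hbd⟩ := hPS
  obtain ⟨hα, hβ⟩ := hsf.measurable_sub ht
  have hcα : Measurable[M.F t] fun ω => chiStar M χ (t + 1) ω * (α t ω - α (t + 1) ω) :=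
    (measurable_chiStar_succ hχ ht.le).mul hα
  rw [← sum_indicator_condExp hP _ hA]
  refine Finset.sum_nonneg fun ω _ => Set.indicator_nonneg (fun ω _ => ?_) ω
  rcases (hP ω).eq_or_lt with h0 | hpos
  · simp [← h0]
  refine mul_nonneg (hP ω) ?_
  rw [condExp_mul_add_mul hP hcα hβ _ hpos]
  obtain ⟨hlo, hhi⟩ := hbd t ht.le ω hpos
  have hliq := hsf.2.2.2 t ht ω
  have hc : 0 ≤ chiStar M χ (t + 1) ω := Finset.sum_nonneg fun s _ => hχ.2.1 s ω
  have hcl := mul_nonneg hc hliq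
  rw [liq] at hcl
  rcases le_total 0 (β t ω - β (t + 1) ω) with hd | hd
  · rw [max_eq_left hd, max_eq_right (neg_nonpos.2 hd)] at hcl
    nlinarith [mul_le_mul_of_nonneg_left hlo hd]
  · rw [max_eq_right hd, max_eq_left (neg_nonneg.2 hd)] at hcl
    nlinarith [mul_le_mul_of_nonpos_left hhi hd]

theorem sum_starVal_le {α β χ S : ℕ → Ω → ℝ} {P : Ω → ℝ}
    (hsf : SelfFinancing M α β) (hχ : IsMixedStop M χ) (hPS : memBarP M χ P S) {t : ℕ}
    (ht : t ≤ M.T) {A : Set Ω} (hA : MeasurableSet[M.F t] A) :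
    ∑ ω, A.indicator (fun ω => P ω *
        starVal M χ (fun s ω' => α s ω' + S s ω' * β s ω') t ω) ω ≤
      ∑ ω, A.indicator (fun ω => P ω *
        (chiStar M χ t ω * α t ω + starVal M χ S t ω * β t ω)) ω := by
  induction ht using Nat.decreasingInduction with
  | self =>
    refine le_of_eq (Finset.sum_congr rfl fun ω _ => congrArg (fun f => A.indicator f ω) ?_)
    funext ω
    simp only [starVal, chiStar, Finset.Icc_self, Finset.sum_singleton]
    ring
  | of_succ t ht ih =>
    have hnext := ih (M.F_mono t.le_succ A hA)
    have htrade := trade_value_nonneg hsf hχ hPS ht hA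
    rw [← sub_nonneg, ← Finset.sum_sub_distrib] at hnext ⊢
    refine (add_nonneg hnext htrade).trans_eq ?_
    rw [← Finset.sum_add_distrib]
    refine Finset.sum_congr rfl fun ω _ => ?_
    by_cases hω : ω ∈ A
    · simp only [Set.indicator_of_mem hω]
      rw [starVal_eq_add S ht.le, starVal_eq_add (fun s ω' => α s ω' + S s ω' * β s ω') ht.le, chiStar_eq_add ht.le]
      ring
    · simp only [Set.indicator_of_notMem hω]
      ring

end Market

/-- For a self-financing strategy (α,β), a mixed stopping time χ and (P,S) ∈ barP(χ):
E_P(χ*_t α_t + S_t^{χ*} β_t | F_t) ≥ E_P((α + Sβ)_t^{χ*} | F_t) P-a.s. for all t, and in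
particular α₀ + E_P(S_χ) β₀ ≥ E_P((α + Sβ)_χ). -/
theorem selffinancing_value_supermartingale (α β : ℕ → Ω → ℝ)
    (hsf : SelfFinancing M α β) (χ : ℕ → Ω → ℝ) (hχ : IsMixedStop M χ)
    (P : Ω → ℝ) (S : ℕ → Ω → ℝ) (hPS : memBarP M χ P S) :
    (∀ t, t ≤ M.T → ∀ ω, 0 < P ω →
        condExp (M.F t) P (starVal M χ (fun s ω' => α s ω' + S s ω' * β s ω') t) ω ≤
          condExp (M.F t) P
            (fun ω' => chiStar M χ t ω' * α t ω' + starVal M χ S t ω' * β t ω') ω) ∧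
    ∀ ω, expect P (mixVal M χ fun s ω' => α s ω' + S s ω' * β s ω') ≤
      α 0 ω + expect P (mixVal M χ S) * β 0 ω := by
  refine ⟨fun t ht ω _ => condExp_le_condExp hPS.1
    (fun A hA => sum_starVal_le hsf hχ hPS ht hA) ω, fun ω => ?_⟩
  have hconst : ∀ {g : Ω → ℝ}, Measurable[M.F 0] g → ∀ ω', g ω' = g ω := by
    intro g hg ω'
    refine sameAtom.eq_of_measurable hg fun A hA => ?_
    rw [M.F_zero, MeasurableSpace.measurableSet_bot_iff] at hA
    rcases hA with rfl | rfl <;> simp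
  have h := sum_starVal_le hsf hχ hPS M.T.zero_le MeasurableSet.univ
  simp only [Set.indicator_univ, starVal_zero, chiStar_zero hχ, hconst hsf.1,
    hconst hsf.2.1] at h
  refine h.trans_eq ?_
  simp only [mul_add, Finset.sum_add_distrib, expect, one_mul, ← mul_assoc, ← Finset.sum_mul]
  rw [hPS.2.1, one_mul]

end RZ
end
end

section
/- Let b ≤ a be real numbers, let f : ℝ → ℝ be convex, and define h(y) = a y⁻ − b y⁺, the infimal convolution g(y) = inf_{y' ∈ ℝ} ( h(y − y') + f(y') ) (a value in ℝ ∪ {−∞}), and the transforms f*(x) = inf_{y ∈ ℝ} ( f(y) + x y ) and g*(x) = inf_{y ∈ ℝ} ( g(y) + x y ), with values in ℝ ∪ {−∞}. Then g*(x) = f*(x) for every x ∈ [b,a], and g*(x) = −∞ for every x ∉ [b,a]. (This expresses the identity gr_{[b,a]}(f)* = dr_{[b,a]}(f*): the conjugate of the gradient restriction of f is the domain restriction of the conjugate of f.) -/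
open MeasureTheory
open scoped Pointwise

noncomputable section

namespace RZ

variable {Ω : Type*} [Fintype Ω]

variable (M : Market Ω)

/-- On `[b,a]` the function `h_{[b,a]}` dominates the linear function `z ↦ -x z`. -/
theorem hfun_add_mul_nonneg {b a x : ℝ} (hx : x ∈ Set.Icc b a) (z : ℝ) :
    0 ≤ hfun b a z + x * z := by
  obtain ⟨hbx, hxa⟩ := hx
  unfold hfun
  rcases le_total 0 z with hz | hz
  · rw [max_eq_right (neg_nonpos.2 hz), max_eq_left hz]
    nlinarith
  · rw [max_eq_left (neg_nonneg.2 hz), max_eq_right hz]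
    nlinarith

/-- The conjugate of the gradient restriction of a convex f equals the conjugate of f
on [b,a] and is −∞ outside [b,a]: gr_{[b,a]}(f)* = dr_{[b,a]}(f*). -/
theorem gradient_restriction_dual (b a : ℝ) (hba : b ≤ a) (f : ℝ → ℝ)
    (hf : ConvexOn ℝ Set.univ f)
    (h : ℝ → ℝ) (hh : ∀ y, h y = a * max (-y) 0 - b * max y 0)
    (g : ℝ → EReal) (hg : ∀ y : ℝ, g y = ⨅ y' : ℝ, ((h (y - y') + f y' : ℝ) : EReal))
    (fstar gstar : ℝ → EReal)
    (hfstar : ∀ x : ℝ, fstar x = ⨅ y : ℝ, ((f y + x * y : ℝ) : EReal))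
    (hgstar : ∀ x : ℝ, gstar x = ⨅ y : ℝ, (g y + ((x * y : ℝ) : EReal))) :
    (∀ x ∈ Set.Icc b a, gstar x = fstar x) ∧
    ∀ x : ℝ, x ∉ Set.Icc b a → gstar x = ⊥ := by
  obtain rfl : h = hfun b a := funext hh
  have gstar_le (x y y' : ℝ) :
      gstar x ≤ ((hfun b a (y - y') + f y' + x * y : ℝ) : EReal) := by
    rw [hgstar, EReal.coe_add]
    refine (iInf_le _ y).trans (add_le_add_left ?_ _)
    rw [hg]
    exact iInf_le _ y'
  refine ⟨fun x hx => le_antisymm ?_ ?_, fun x hx => ?_⟩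
  · rw [hfstar]
    refine le_iInf fun y => ?_
    simpa [hfun] using gstar_le x y y
  · rw [hgstar]
    refine le_iInf fun y => ?_
    rw [← EReal.sub_le_iff_le_add (.inl (EReal.coe_ne_bot _)) (.inl (EReal.coe_ne_top _)), hg]
    refine le_iInf fun y' => ?_
    rw [EReal.sub_le_iff_le_add (.inl (EReal.coe_ne_bot _)) (.inl (EReal.coe_ne_top _)),
      hfstar, ← EReal.coe_add]
    refine (iInf_le _ y').trans (EReal.coe_le_coe_iff.2 ?_)
    linarith [hfun_add_mul_nonneg hx (y - y')]
  · rw [EReal.eq_bot_iff_forall_lt]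
    intro c
    set k := |f 0 - c| + 1 with hk
    have hk_pos : 0 < k := by positivity
    have hck : f 0 - k < c := by linarith [le_abs_self (f 0 - c)]
    rcases lt_or_ge x b with hxb | hbx
    · have hd : 0 < b - x := sub_pos.2 hxb
      have ht : 0 < k / (b - x) := div_pos hk_pos hd
      refine (gstar_le x (k / (b - x)) 0).trans_lt (EReal.coe_lt_coe_iff.2 ?_)
      have hmul : (b - x) * (k / (b - x)) = k := mul_div_cancel₀ k hd.ne'
      rw [hfun, sub_zero, max_eq_right (neg_nonpos.2 ht.le), max_eq_left ht.le]
      linarith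
    · have hd : 0 < x - a := sub_pos.2 (not_le.1 fun hxa => hx ⟨hbx, hxa⟩)
      have ht : 0 < k / (x - a) := div_pos hk_pos hd
      refine (gstar_le x (-(k / (x - a))) 0).trans_lt (EReal.coe_lt_coe_iff.2 ?_)
      have hmul : (x - a) * (k / (x - a)) = k := mul_div_cancel₀ k hd.ne'
      rw [hfun, sub_zero, neg_neg, max_eq_left ht.le, max_eq_right (neg_nonpos.2 ht.le)]
      linarith

end RZ
end
end
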